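/- Consider the supervision game restricted to the human type whose model deems the plan π_pr unsafe. Assume: (i) V > C_P^H(π_pr) + I_P; (ii) C_E^H(π̂) + I_E > C_P^H(π_pr) + I_P; (iii) C_P^H(π_s) > 0 and C_E^H(π_s) > 0; (iv) C_P^R(π_pr) + C_E^R(π_pr) < C_P^R(π_s) + C_E^R(π_s); and (v) C_P^R(π_pr) + C_G̃ > C_P^R(π_s) + C_E^R(π_s). Then the resulting 2×3 game has no pure-strategy Nash equilibrium. -/

import Mathlib

set_option linter.constructorNameAsVariable false

/-- Robot strategies: the probably-risky plan `pr` and the safe plan `s`. -/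
inductive RStrat | pr | s
deriving DecidableEq

/-- Human strategies: observe the plan, observe the execution, or do not observe. -/
inductive HStrat | OP | OE | NO
deriving DecidableEq

/-- Pure-strategy Nash equilibrium of a two-player game. -/
def IsNash (UR UH : RStrat → HStrat → ℝ) (s : RStrat) (t : HStrat) : Prop :=
  (∀ s', UR s' t ≤ UR s t) ∧ (∀ t', UH s t' ≤ UH s t)

/-- For the human type deeming π_pr unsafe, under hypotheses (i)–(v),
the 2×3 supervision game has no pure-strategy Nash equilibrium. -/
theorem stmt_0
    (CPRpr CPRs CERpr CERs CERhat CG CPHpr CPHs CEHhat CEHs IP IE V : ℝ)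
    (hCPRpr : 0 ≤ CPRpr) (hCPRs : 0 ≤ CPRs) (hCERpr : 0 ≤ CERpr)
    (hCERs : 0 ≤ CERs) (hCERhat : 0 ≤ CERhat) (hCG : 0 ≤ CG)
    (hCPHpr : 0 ≤ CPHpr) (hCPHs : 0 ≤ CPHs) (hCEHhat : 0 ≤ CEHhat)
    (hCEHs : 0 ≤ CEHs) (hIP : 0 ≤ IP) (hIE : 0 ≤ IE) (hV : 0 ≤ V)
    (h1 : CPHpr + IP < V)
    (h2 : CPHpr + IP < CEHhat + IE)
    (h3P : 0 < CPHs) (h3E : 0 < CEHs)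
    (h4 : CPRpr + CERpr < CPRs + CERs)
    (h5 : CPRs + CERs < CPRpr + CG) :
    ¬ ∃ (s : RStrat) (t : HStrat), IsNash
      (fun s t => match s, t with
        | RStrat.pr, HStrat.OP => -CPRpr - CG
        | RStrat.pr, HStrat.OE => -CPRpr - CERhat - CG
        | RStrat.pr, HStrat.NO => -CPRpr - CERpr
        | RStrat.s, _ => -CPRs - CERs)
      (fun s t => match s, t with
        | RStrat.pr, HStrat.OP => -CPHpr - IP
        | RStrat.pr, HStrat.OE => -CEHhat - IE
        | RStrat.pr, HStrat.NO => -V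
        | RStrat.s, HStrat.OP => -CPHs
        | RStrat.s, HStrat.OE => -CEHs
        | RStrat.s, HStrat.NO => 0)
      s t := by
  rintro ⟨s, t, hR, hH⟩
  have a := hR RStrat.pr
  have b := hR RStrat.s
  have c := hH HStrat.OP
  have d := hH HStrat.NO
  cases s <;> cases t <;> dsimp only at a b c d <;> linarith
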